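/- Let L be a field, let n ≥ 1, and let Q₁, …, Q_{n+1} ∈ L[x₁, …, xₙ] be non-constant polynomials with total degrees deg Qᵢ = dᵢ. If the field extension L(x₁, …, xₙ) is algebraic (equivalently finite) over its subfield L(Q₁, …, Q_{n+1}) (i.e. the map Q = (Q₁, …, Q_{n+1}) : Lⁿ → L^{n+1} is generically finite), then there exists a non-zero polynomial W ∈ L[T₁, …, T_{n+1}] such that (a) W(Q₁, …, Q_{n+1}) = 0 in L[x₁, …, xₙ], and (b) the total degree of the polynomial W(T₁^{d₁}, T₂^{d₂}, …, T_{n+1}^{d_{n+1}}) is at most d₁·d₂⋯d_{n+1}. -/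

import Mathlib

theorem Nat.sum_range_multichoose_eq (k N : ℕ) :
    ∑ m ∈ Finset.range (N + 1), k.multichoose m = (k + 1).multichoose N := by
  induction N with
  | zero => simp
  | succ N ih => rw [Finset.sum_range_succ, ih, Nat.multichoose_succ_succ, add_comm]

/-- The exponent vectors of weighted degree at most `N`, for the weights `d`. -/
def weightedSimplex {k : ℕ} (d : Fin k → ℕ) (N : ℕ) : Set (Fin k →₀ ℕ) :=
  {a | ∑ i, a i * d i ≤ N}

theorem finite_weightedSimplex {k : ℕ} {d : Fin k → ℕ} (hd : ∀ i, d i ≠ 0) (N : ℕ) :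
    (weightedSimplex d N).Finite := by
  refine (Set.finite_Iic (Finsupp.equivFunOnFinite.symm fun _ => N)).subset fun a ha i => ?_
  have h1 : a i * d i ≤ ∑ i, a i * d i :=
    Finset.single_le_sum (f := fun i => a i * d i) (fun _ _ => Nat.zero_le _) (Finset.mem_univ i)
  have h2 : a i ≤ a i * d i := Nat.le_mul_of_pos_right _ (Nat.pos_of_ne_zero (hd i))
  exact (h2.trans h1).trans ha

theorem ncard_weightedSimplex_one (k N : ℕ) :
    (weightedSimplex (fun _ : Fin k => 1) N).ncard = (k + 1).multichoose N := by
  classical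
  have : weightedSimplex (fun _ : Fin k => 1) N =
      ((Finset.range (N + 1)).biUnion
        fun m => (Finset.univ : Finset (Fin k)).finsuppAntidiag m : Finset (Fin k →₀ ℕ)) := by
    ext a
    simp [weightedSimplex]
  rw [this, Set.ncard_coe_finset, Finset.card_biUnion, ← Nat.sum_range_multichoose_eq]
  · simp [Finset.card_finsuppAntidiag_nat_eq_multichoose]
  · intro a _ b _ hab
    rw [Function.onFun, Finset.disjoint_left]
    intro x hx hxb
    simp only [Finset.mem_finsuppAntidiag] at hx hxb
    exact hab (hx.1.symm.trans hxb.1)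

/-- Dividing the exponents by the weights compares the standard simplex with the weighted one. -/
theorem multichoose_le_prod_mul_ncard_weightedSimplex {k : ℕ} {d : Fin k → ℕ}
    (hd : ∀ i, d i ≠ 0) (N : ℕ) :
    (k + 1).multichoose N ≤ (∏ i, d i) * (weightedSimplex d N).ncard := by
  have : ∀ i, NeZero (d i) := fun i => ⟨hd i⟩
  have := (finite_weightedSimplex hd N).to_subtype
  let f : weightedSimplex (fun _ : Fin k => 1) N → (∀ i, Fin (d i)) × weightedSimplex d N :=
    fun a => (fun i => Fin.ofNat (d i) (a.1 i),
      ⟨Finsupp.equivFunOnFinite.symm fun i => a.1 i / d i, by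
        have := a.2
        simp only [weightedSimplex, Set.mem_ofPred_eq, mul_one] at this ⊢
        exact (Finset.sum_le_sum fun i _ => Nat.div_mul_le_self _ _).trans this⟩)
  have hf : Function.Injective f := by
    rintro ⟨a, ha⟩ ⟨b, hb⟩ hab
    simp only [f, Prod.mk.injEq, Subtype.mk.injEq, funext_iff, Fin.ext_iff, Fin.val_ofNat,
      EmbeddingLike.apply_eq_iff_eq] at hab
    ext i
    simp only
    rw [← Nat.div_add_mod (a i) (d i), ← Nat.div_add_mod (b i) (d i), hab.1 i, hab.2 i]
  have := Nat.card_le_card_of_injective f hf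
  rwa [Nat.card_prod, Nat.card_pi, Nat.card_coe_set_eq, Nat.card_coe_set_eq,
    ncard_weightedSimplex_one, Finset.prod_congr rfl fun i _ => Nat.card_fin (d i)] at this

theorem Nat.multichoose_mono_right (k : ℕ) : Monotone (k + 1).multichoose := by
  refine monotone_nat_of_le_succ fun m => ?_
  rw [Nat.multichoose_succ_succ]
  exact Nat.le_add_left _ _

theorem Nat.succ_add_mul_multichoose (n x : ℕ) :
    (x + n + 1) * (n + 1).multichoose x = (n + 1) * (n + 2).multichoose x := by
  rw [Nat.multichoose_eq, Nat.multichoose_eq,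
    show n + 1 + x - 1 = n + x by omega, show n + 2 + x - 1 = n + x + 1 by omega,
    ← Nat.choose_symm_add, ← Nat.choose_symm_of_eq_add (show n + x + 1 = (n + 1) + x by omega),
    mul_comm (n + 1), ← Nat.add_one_mul_choose_eq, add_comm x n]

/-- If the weighted simplices in dimension `n + 1` grow in steps of length `w` at most as fast as
the standard simplices in dimension `n`, then `w` is at most the product of the weights. -/
theorem le_prod_of_ncard_weightedSimplex_le {n w : ℕ} {d : Fin (n + 1) → ℕ} (hd : ∀ i, d i ≠ 0)
    (h : ∀ N, (weightedSimplex d (N + w)).ncard ≤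
      (weightedSimplex d N).ncard + (n + 1).multichoose (N + w)) :
    w ≤ ∏ i, d i := by
  by_contra! hlt
  set D := ∏ i, d i
  set S : ℕ → ℕ := fun k => ∑ i ∈ Finset.range k, (n + 1).multichoose (i * w) with hS
  have hSsucc (k : ℕ) : S (k + 1) = S k + (n + 1).multichoose (k * w) := Finset.sum_range_succ _ _
  have hupper (k : ℕ) : (weightedSimplex d (k * w)).ncard ≤ S (k + 1) := by
    induction k with
    | zero =>
      have : weightedSimplex d (0 * w) = {0} := by
        ext a
        simp [weightedSimplex, hd, Finsupp.ext_iff]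
      rw [this]
      simp [hS]
    | succ k ih =>
      rw [hSsucc, add_mul, one_mul]
      exact (h _).trans (Nat.add_le_add_right ih _)
  have hblock (k : ℕ) : w * S k ≤ ∑ m ∈ Finset.range (k * w), (n + 1).multichoose m := by
    induction k with
    | zero => simp [hS]
    | succ k ih =>
      rw [hSsucc, mul_add, add_mul, one_mul, Finset.sum_range_add]
      refine Nat.add_le_add ih ?_
      refine (Finset.card_nsmul_le_sum _ _ ((n + 1).multichoose (k * w)) fun i _ => ?_).trans' ?_
      · exact Nat.multichoose_mono_right n (Nat.le_add_right _ _)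
      · simp
  have hmain (k : ℕ) : (n + 2).multichoose (k * w) ≤ D * S (k + 1) :=
    (multichoose_le_prod_mul_ncard_weightedSimplex hd _).trans (Nat.mul_le_mul_left _ (hupper k))
  have hlow (k : ℕ) : w * S k ≤ (n + 2).multichoose (k * w) :=
    (hblock k).trans ((Finset.sum_le_sum_of_subset (Finset.range_mono (Nat.le_succ _))).trans
      (Nat.sum_range_multichoose_eq _ _).le)
  set k := (n + 1) * (D * (D + 1)) with hk
  set c := (n + 1).multichoose (k * w) with hc
  have hSk : S k ≤ D * c := by
    have h1 := (hlow k).trans (hmain k)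
    rw [hSsucc, mul_add, ← hc] at h1
    have h2 : (D + 1) * S k ≤ w * S k := Nat.mul_le_mul_right _ hlt
    rw [add_mul, one_mul] at h2
    omega
  have hcpos : 0 < c := lt_of_lt_of_le (by simp) (Nat.multichoose_mono_right n (Nat.zero_le (k * w)))
  have hfin : (k * w + n + 1) * c ≤ k * c :=
    calc (k * w + n + 1) * c = (n + 1) * (n + 2).multichoose (k * w) :=
          Nat.succ_add_mul_multichoose n (k * w)
      _ ≤ (n + 1) * (D * (S k + c)) := Nat.mul_le_mul_left _ (by rw [hc, ← hSsucc]; exact hmain k)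
      _ ≤ (n + 1) * (D * (D * c + c)) := by gcongr
      _ = k * c := by rw [hk]; ring
  have h3 := Nat.le_of_mul_le_mul_right hfin hcpos
  have h4 : k ≤ k * w := Nat.le_mul_of_pos_right _ (by omega)
  omega

theorem MvPolynomial.aeval_X_pow_eq_sum {R : Type*} [CommRing R] {k : ℕ} (d : Fin k → ℕ)
    (V : MvPolynomial (Fin k) R) :
    aeval (fun i => (X i : MvPolynomial (Fin k) R) ^ d i) V =
      ∑ m ∈ V.support, monomial (Finsupp.equivFunOnFinite.symm fun i => m i * d i) (coeff m V) := by
  rw [aeval_def, eval₂_eq']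
  refine Finset.sum_congr rfl fun m _ => ?_
  rw [monomial_eq, Finsupp.prod_fintype _ _ (by simp)]
  simp [← pow_mul, mul_comm, algebraMap_eq]

theorem MvPolynomial.coeff_aeval_X_pow {R : Type*} [CommRing R] {k : ℕ} {d : Fin k → ℕ}
    (hd : ∀ i, d i ≠ 0) (V : MvPolynomial (Fin k) R) (a : Fin k →₀ ℕ) :
    coeff (Finsupp.equivFunOnFinite.symm fun i => a i * d i)
      (aeval (fun i => (X i : MvPolynomial (Fin k) R) ^ d i) V) = coeff a V := by
  classical
  have hinj (m : Fin k →₀ ℕ) : (Finsupp.equivFunOnFinite.symm fun i => m i * d i) =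
      (Finsupp.equivFunOnFinite.symm fun i => a i * d i) ↔ m = a := by
    simp only [Finsupp.ext_iff, Finsupp.equivFunOnFinite_symm_apply_apply]
    simp [hd]
  rw [aeval_X_pow_eq_sum, coeff_sum]
  simp [coeff_monomial, hinj, eq_comm]

theorem MvPolynomial.aeval_X_pow_ne_zero {R : Type*} [CommRing R] {k : ℕ} {d : Fin k → ℕ}
    (hd : ∀ i, d i ≠ 0) {V : MvPolynomial (Fin k) R} (hV : V ≠ 0) :
    aeval (fun i => (X i : MvPolynomial (Fin k) R) ^ d i) V ≠ 0 := by
  obtain ⟨a, ha⟩ := ne_zero_iff.1 hV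
  exact fun h => ha (by rw [← coeff_aeval_X_pow hd, h, coeff_zero])

theorem MvPolynomial.mem_restrictSupport_weightedSimplex {R : Type*} [CommRing R] {k : ℕ}
    {d : Fin k → ℕ} (hd : ∀ i, d i ≠ 0) {N : ℕ} {V : MvPolynomial (Fin k) R} :
    V ∈ restrictSupport R (weightedSimplex d N) ↔
      (aeval (fun i => (X i : MvPolynomial (Fin k) R) ^ d i) V).totalDegree ≤ N := by
  rw [mem_restrictSupport_iff]
  constructor
  · intro h
    rw [aeval_X_pow_eq_sum]
    refine totalDegree_finsetSum_le fun m hm => (totalDegree_monomial_le _ _).trans ?_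
    have := h hm
    rw [Finsupp.sum_fintype _ _ (by simp)]
    simpa [weightedSimplex] using this
  · intro h a ha
    have := le_totalDegree (p := aeval (fun i => (X i : MvPolynomial (Fin k) R) ^ d i) V)
      (s := Finsupp.equivFunOnFinite.symm fun i => a i * d i)
      (by rw [mem_support_iff, coeff_aeval_X_pow hd]; exact mem_support_iff.1 ha)
    rw [Finsupp.sum_fintype _ _ (by simp)] at this
    exact le_trans (by simp) (this.trans h)

theorem MvPolynomial.totalDegree_aeval_le_of_mem_restrictSupport {R σ : Type*} [CommRing R] {k : ℕ}
    {Q : Fin k → MvPolynomial σ R} {d : Fin k → ℕ} (hQ : ∀ i, (Q i).totalDegree ≤ d i) {N : ℕ}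
    {V : MvPolynomial (Fin k) R} (hV : V ∈ restrictSupport R (weightedSimplex d N)) :
    (aeval Q V).totalDegree ≤ N := by
  rw [mem_restrictSupport_iff] at hV
  rw [aeval_def, eval₂_eq']
  refine totalDegree_finsetSum_le fun m hm => ?_
  rw [algebraMap_eq]
  refine (totalDegree_mul _ _).trans ?_
  rw [totalDegree_C, zero_add]
  refine (totalDegree_finsetProd _ _).trans (le_trans ?_ (hV hm))
  refine Finset.sum_le_sum fun i _ => (totalDegree_pow _ _).trans ?_
  exact Nat.mul_le_mul_left _ (hQ i)

theorem MvPolynomial.finrank_restrictSupport {R σ : Type*} [CommRing R] [StrongRankCondition R]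
    (s : Set (σ →₀ ℕ)) : Module.finrank R (restrictSupport R s) = s.ncard := by
  rw [Module.finrank_eq_nat_card_basis (basisRestrictSupport R s), Nat.card_coe_set_eq]

theorem MvPolynomial.restrictTotalDegree_eq_restrictSupport {R : Type*} [CommRing R] (n N : ℕ) :
    restrictTotalDegree (Fin n) R N = restrictSupport R (weightedSimplex (fun _ => 1) N) := by
  rw [restrictTotalDegree]
  congr 1
  ext a
  simp [weightedSimplex, Finsupp.sum_fintype]

/-- Rank-nullity for the evaluation `V ↦ V(Q)` on polynomials of bounded weighted degree, when all
relations between the `Q i` are multiples of `W`. -/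
theorem MvPolynomial.ncard_weightedSimplex_add_le {L : Type*} [Field L] {k n : ℕ}
    {Q : Fin k → MvPolynomial (Fin n) L} {d : Fin k → ℕ} (hd : ∀ i, d i ≠ 0)
    (hQ : ∀ i, (Q i).totalDegree ≤ d i) {W : MvPolynomial (Fin k) L} (hW : W ≠ 0)
    (hker : ∀ V : MvPolynomial (Fin k) L, aeval Q V = 0 → W ∣ V) (N : ℕ) :
    (weightedSimplex d
        (N + (aeval (fun i => (X i : MvPolynomial (Fin k) L) ^ d i) W).totalDegree)).ncard ≤
      (weightedSimplex d N).ncard + (n + 1).multichoose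
        (N + (aeval (fun i => (X i : MvPolynomial (Fin k) L) ^ d i) W).totalDegree) := by
  set E : MvPolynomial (Fin k) L →ₐ[L] MvPolynomial (Fin k) L := aeval (fun i => X i ^ d i)
  set M := N + (E W).totalDegree
  have (N : ℕ) : Module.Finite L (restrictSupport L (weightedSimplex d N)) :=
    have := (finite_weightedSimplex hd N).to_subtype
    .of_basis (basisRestrictSupport L _)
  let ψ : restrictSupport L (weightedSimplex d M) →ₗ[L] restrictTotalDegree (Fin n) L M :=
    (aeval (R := L) Q).toLinearMap.restrict fun V hV =>
      (mem_restrictTotalDegree _ _ _).2 (totalDegree_aeval_le_of_mem_restrictSupport hQ hV)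
  have hrange : Module.finrank L (LinearMap.range ψ) ≤ (n + 1).multichoose M := by
    refine (Submodule.finrank_le _).trans ?_
    rw [restrictTotalDegree_eq_restrictSupport, finrank_restrictSupport, ncard_weightedSimplex_one]
  have hkerdim : Module.finrank L (LinearMap.ker ψ) ≤ (weightedSimplex d N).ncard := by
    rw [← finrank_restrictSupport (R := L), ← Submodule.finrank_map_subtype_eq]
    refine le_trans (Submodule.finrank_mono (t :=
      (restrictSupport L (weightedSimplex d N)).map (LinearMap.mulLeft L W)) ?_)
      (Submodule.finrank_map_le _ _)
    rintro _ ⟨⟨V, hV⟩, hVker, rfl⟩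
    obtain ⟨U, rfl⟩ := hker V (congrArg Subtype.val hVker)
    refine ⟨U, ?_, rfl⟩
    rcases eq_or_ne U 0 with rfl | hU
    · exact zero_mem _
    · have hV' := (mem_restrictSupport_weightedSimplex hd).1 hV
      change (E (W * U)).totalDegree ≤ _ at hV'
      rw [map_mul, totalDegree_mul_of_isDomain (aeval_X_pow_ne_zero hd hW)
        (aeval_X_pow_ne_zero hd hU)] at hV'
      change (E W).totalDegree + (E U).totalDegree ≤ N + (E W).totalDegree at hV'
      refine (mem_restrictSupport_weightedSimplex hd).2 ?_
      change (E U).totalDegree ≤ N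
      omega
  rw [← finrank_restrictSupport (R := L), ← ψ.finrank_range_add_finrank_ker]
  omega

open MvPolynomial in
/-- An algebra homomorphism out of a domain is injective if its image contains as many
algebraically independent elements as the transcendence degree of the domain. -/
theorem AlgebraicIndependent.injective_of_comp {R A B : Type*} {κ : Type*} [CommRing R]
    [Nontrivial R] [CommRing A] [IsDomain A] [CommRing B] [Algebra R A] [Algebra R B] [Finite κ]
    (f : A →ₐ[R] B) {x : κ → A} (hx : AlgebraicIndependent R (f ∘ x))
    (h : Algebra.trdeg R A ≤ Nat.card κ) : Function.Injective f := by
  have hxA : AlgebraicIndependent R x := .of_comp f hx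
  have hb : IsTranscendenceBasis R x :=
    hxA.isTranscendenceBasis_of_lift_trdeg_le_of_finite (by
      rw [← Nat.cast_card, Cardinal.lift_natCast]
      simpa using h)
  have := hb.isAlgebraic
  rw [injective_iff_map_eq_zero]
  intro a ha
  by_contra hne
  obtain ⟨r, hr, b, hb⟩ := (Algebra.IsAlgebraic.isAlgebraic
    (R := Algebra.adjoin R (Set.range x)) a).exists_nonzero_dvd (mem_nonZeroDivisors_of_ne_zero hne)
  obtain ⟨r, hrm⟩ := r
  obtain ⟨p, rfl⟩ : ∃ p, aeval x p = r := by
    rwa [Algebra.adjoin_range_eq_range_aeval] at hrm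
  have hp : aeval (f ∘ x) p = 0 := by
    have := congrArg f hb
    change f (aeval x p) = _ at this
    rw [map_mul, ha, zero_mul, MvPolynomial.comp_aeval_apply] at this
    exact this
  have := hx.eq_zero_of_aeval_eq_zero p hp
  subst this
  exact hr (Subtype.ext (map_zero _))

/-- The transcendence degree of a proper quotient domain of a polynomial ring in `n + 1` variables
is at most `n`. -/
theorem MvPolynomial.trdeg_quotient_le {L : Type*} [Field L] {n : ℕ}
    (I : Ideal (MvPolynomial (Fin (n + 1)) L)) [I.IsPrime] (hI : I ≠ ⊥) :
    Algebra.trdeg L (MvPolynomial (Fin (n + 1)) L ⧸ I) ≤ n := by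
  by_contra! hlt
  set t : Fin (n + 1) → MvPolynomial (Fin (n + 1)) L ⧸ I := fun i => Ideal.Quotient.mk I (X i)
  have hev : aeval t = Ideal.Quotient.mkₐ L I := by
    ext i; simp [t]
  have htop : Algebra.adjoin L (Set.range t) = ⊤ := by
    rw [Algebra.adjoin_range_eq_range_aeval, hev]
    exact AlgHom.range_eq_top _ |>.2 (Ideal.Quotient.mkₐ_surjective L I)
  have : Algebra.IsAlgebraic (Algebra.adjoin L (Set.range t))
      (MvPolynomial (Fin (n + 1)) L ⧸ I) :=
    ⟨fun a => isAlgebraic_algebraMap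
      (⟨a, htop ▸ Algebra.mem_top⟩ : Algebra.adjoin L (Set.range t))⟩
  have hb : IsTranscendenceBasis L t :=
    Algebra.IsAlgebraic.isTranscendenceBasis_of_lift_le_trdeg_of_finite L t (by
      have := Order.succ_le_of_lt hlt
      simpa using this)
  have hinj := hb.1
  rw [algebraicIndependent_iff_injective_aeval, hev] at hinj
  apply hI
  rw [eq_bot_iff]
  intro p hp
  exact hinj (by simpa using Ideal.Quotient.eq_zero_iff_mem.2 hp)

/-- The ideal of relations between `n + 1` elements over which a domain of transcendence degree
`n` is algebraic is principal and non-zero. -/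
theorem MvPolynomial.exists_generator_ker_aeval {L K : Type*} [Field L] [CommRing K] [IsDomain K]
    [Algebra L K] {n : ℕ} (hK : Algebra.trdeg L K = n) (q : Fin (n + 1) → K)
    [Algebra.IsAlgebraic (Algebra.adjoin L (Set.range q)) K] :
    ∃ W : MvPolynomial (Fin (n + 1)) L, W ≠ 0 ∧ aeval q W = 0 ∧
      ∀ V : MvPolynomial (Fin (n + 1)) L, aeval q V = 0 → W ∣ V := by
  set P : Ideal (MvPolynomial (Fin (n + 1)) L) := RingHom.ker (aeval (R := L) q)
  have hP : P ≠ ⊥ := by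
    intro hbot
    have hq : AlgebraicIndependent L q := by
      rw [algebraicIndependent_iff_injective_aeval]
      exact (RingHom.injective_iff_ker_eq_bot _).2 hbot
    have := hq.lift_cardinalMk_le_trdeg
    rw [hK] at this
    simp only [Cardinal.mk_fin, Cardinal.lift_natCast] at this
    norm_cast at this
    omega
  have hPprime : P.IsPrime := RingHom.ker_isPrime _
  obtain ⟨W, hWP, hW⟩ := hPprime.exists_mem_prime_of_ne_bot hP
  refine ⟨W, hW.ne_zero, hWP, fun V hV => ?_⟩
  obtain ⟨s, hs, hsb⟩ := exists_isTranscendenceBasis_subset (R := L) (Set.range q)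
  have hcard : Cardinal.mk s = n := by rw [hsb.cardinalMk_eq_trdeg, hK]
  have hfin : Finite s := (Set.finite_range q).subset hs
  have : (Ideal.span {W}).IsPrime := (Ideal.span_singleton_prime hW.ne_zero).2 hW
  have hle : ∀ a ∈ Ideal.span {W}, aeval (R := L) q a = 0 := by
    have : Ideal.span {W} ≤ P := by simpa [Ideal.span_le] using hWP
    exact fun a ha => this ha
  choose j hj using fun y : s => hs y.2
  have hinj := AlgebraicIndependent.injective_of_comp
    (Ideal.Quotient.liftₐ (Ideal.span {W}) (aeval (R := L) q) hle)
    (x := fun y : s => Ideal.Quotient.mk _ (X (j y)))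
    (by
      convert hsb.1 using 1
      ext y
      change aeval q (X (j y)) = _
      simp [hj])
    (by
      refine (trdeg_quotient_le _ ?_).trans ?_
      · simpa using hW.ne_zero
      · rw [Nat.card, hcard]; simp)
  rw [← Ideal.mem_span_singleton, ← Ideal.Quotient.eq_zero_iff_mem]
  apply hinj
  rw [map_zero]
  exact hV

/-- **Perron's Theorem.** If `Q₁, …, Q_{n+1}` are non-constant polynomials in `n` variables
over a field `L` of degrees `d₁, …, d_{n+1}`, and the rational function field `L(x₁,…,xₙ)` is
algebraic over the subfield `L(Q₁,…,Q_{n+1})`, then there is a non-zero polynomial `W` in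
`n+1` variables with `W(Q₁,…,Q_{n+1}) = 0` and
`deg W(T₁^{d₁},…,T_{n+1}^{d_{n+1}}) ≤ d₁⋯d_{n+1}`. -/
theorem perron_theorem
    (L : Type*) [Field L] (n : ℕ) (hn : 1 ≤ n)
    (Q : Fin (n + 1) → MvPolynomial (Fin n) L)
    (d : Fin (n + 1) → ℕ)
    (hQnonconst : ∀ i, (Q i).totalDegree ≠ 0)
    (hdeg : ∀ i, (Q i).totalDegree = d i)
    (halg : Algebra.IsAlgebraic
      (IntermediateField.adjoin L
        (Set.range fun i => algebraMap (MvPolynomial (Fin n) L)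
          (FractionRing (MvPolynomial (Fin n) L)) (Q i)))
      (FractionRing (MvPolynomial (Fin n) L))) :
    ∃ W : MvPolynomial (Fin (n + 1)) L,
      W ≠ 0 ∧
      MvPolynomial.aeval Q W = 0 ∧
      (MvPolynomial.aeval
          (fun i => (MvPolynomial.X i : MvPolynomial (Fin (n + 1)) L) ^ d i) W).totalDegree
        ≤ ∏ i, d i := by
  have hd : ∀ i, d i ≠ 0 := fun i => hdeg i ▸ hQnonconst i
  set K := FractionRing (MvPolynomial (Fin n) L)
  have : Algebra.IsAlgebraic (MvPolynomial (Fin n) L) K :=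
    IsLocalization.isAlgebraic _ (nonZeroDivisors (MvPolynomial (Fin n) L))
  have htr : Algebra.trdeg L K = n := by
    have := ((IsTranscendenceBasis.mvPolynomial (Fin n) L).algebraMap_comp
      (A := K)).lift_cardinalMk_eq_trdeg
    simpa using this.symm
  have := IntermediateField.isAlgebraic_adjoin_iff_top.1 halg
  obtain ⟨W, hW, hW0, hWdvd⟩ := MvPolynomial.exists_generator_ker_aeval htr
    (fun i => algebraMap (MvPolynomial (Fin n) L) K (Q i))
  have hev (V : MvPolynomial (Fin (n + 1)) L) :
      MvPolynomial.aeval (fun i => algebraMap (MvPolynomial (Fin n) L) K (Q i)) V = 0 ↔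
        MvPolynomial.aeval Q V = 0 :=
    MvPolynomial.aeval_algebraMap_eq_zero_iff K Q V
  refine ⟨W, hW, (hev W).1 hW0, le_prod_of_ncard_weightedSimplex_le hd fun N => ?_⟩
  exact MvPolynomial.ncard_weightedSimplex_add_le hd (fun i => (hdeg i).le) hW
    (fun V hV => hWdvd V ((hev V).2 hV)) N
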